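/- arXiv:2302.05389 — 10 statements merged into one kernel-verified Lean document; each statement's English description precedes it below -/
import Mathlib

section
/- Let (f₀, x₀) be an extremal pair for γ. Then (‖γ‖² − 1)·⟨γ(f₀)x₀, x₀⟩ = 0. In particular, if ‖γ‖ > 1, then ⟨γ(f₀)x₀, x₀⟩ = 0. -/
open scoped InnerProductSpace

theorem Complex.norm_sub_le_norm_one_sub_conj_mul {a w : ℂ} (ha : ‖a‖ ≤ 1) (hw : ‖w‖ ≤ 1) :
    ‖w - a‖ ≤ ‖1 - starRingEnd ℂ a * w‖ := by
  have ha' : a.re * a.re + a.im * a.im ≤ 1 := by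
    rw [← Complex.normSq_apply, Complex.normSq_eq_norm_sq]
    exact pow_le_one₀ (norm_nonneg a) ha
  have hw' : w.re * w.re + w.im * w.im ≤ 1 := by
    rw [← Complex.normSq_apply, Complex.normSq_eq_norm_sq]
    exact pow_le_one₀ (norm_nonneg w) hw
  refine le_of_pow_le_pow_left₀ two_ne_zero (norm_nonneg _) ?_
  rw [← Complex.normSq_eq_norm_sq, ← Complex.normSq_eq_norm_sq]
  simp only [Complex.normSq_apply, Complex.sub_re, Complex.sub_im, Complex.mul_re, Complex.mul_im,
    Complex.conj_re, Complex.conj_im, Complex.one_re, Complex.one_im]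
  nlinarith [mul_nonneg (sub_nonneg.2 ha') (sub_nonneg.2 hw')]

/-- A closed subalgebra of `C(K, ℂ)` is stable under composition of the elements of its unit ball
with the disc automorphisms `w ↦ (w - a) / (1 - conj a * w)`. -/
theorem Subalgebra.exists_norm_le_one_mul_one_sub_smul {K : Type*} [TopologicalSpace K]
    [CompactSpace K] (A : Subalgebra ℂ C(K, ℂ)) (hA : IsClosed (A : Set C(K, ℂ)))
    (f : A) (hf : ‖f‖ ≤ 1) {a : ℂ} (ha : ‖a‖ < 1) :
    ∃ g : A, ‖g‖ ≤ 1 ∧ g * (1 - starRingEnd ℂ a • f) = f - a • 1 := by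
  have : CompleteSpace A := hA.completeSpace_coe
  have hlt : ‖starRingEnd ℂ a • f‖ < 1 := by
    rw [norm_smul, RCLike.norm_conj]
    exact (mul_le_of_le_one_right (norm_nonneg a) hf).trans_lt ha
  obtain ⟨u, hu⟩ := isUnit_one_sub_of_norm_lt_one hlt
  have hg : (f - a • 1) * (↑u⁻¹ : A) * (1 - starRingEnd ℂ a • f) = f - a • 1 := by
    rw [← hu, Units.inv_mul_cancel_right]
  refine ⟨(f - a • 1) * (↑u⁻¹ : A), ?_, hg⟩
  generalize (f - a • 1) * (↑u⁻¹ : A) = g at hg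
  refine (ContinuousMap.norm_le (g : C(K, ℂ)) zero_le_one).2 fun k => ?_
  have hk : (g : C(K, ℂ)) k * (1 - starRingEnd ℂ a * (f : C(K, ℂ)) k)
      = (f : C(K, ℂ)) k - a := by
    simpa using congrArg (fun h : A => (h : C(K, ℂ)) k) hg
  have hfk : ‖(f : C(K, ℂ)) k‖ ≤ 1 := ((f : C(K, ℂ)).norm_coe_le_norm k).trans hf
  have hpos : 0 < ‖1 - starRingEnd ℂ a * (f : C(K, ℂ)) k‖ := by
    refine norm_pos_iff.2 (sub_ne_zero.2 fun h => ?_)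
    have h1 := congrArg norm h
    rw [norm_one, norm_mul, RCLike.norm_conj] at h1
    exact (mul_le_of_le_one_right (norm_nonneg a) hfk).not_gt (h1 ▸ ha)
  refine le_of_mul_le_mul_right ?_ hpos
  rw [← norm_mul, hk, one_mul]
  exact Complex.norm_sub_le_norm_one_sub_conj_mul ha.le hfk

/-- Von Neumann type inequality for disc automorphisms applied to a bounded homomorphism. -/
theorem Subalgebra.norm_apply_sub_smul_le {K : Type*} [TopologicalSpace K]
    [CompactSpace K] (A : Subalgebra ℂ C(K, ℂ)) (hA : IsClosed (A : Set C(K, ℂ)))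
    {H : Type*} [NormedAddCommGroup H] [InnerProductSpace ℂ H] (γ : A →L[ℂ] (H →L[ℂ] H))
    (hmul : ∀ f g : A, γ (f * g) = γ f * γ g) (hone : γ 1 = 1)
    (f : A) (hf : ‖f‖ ≤ 1) {a : ℂ} (ha : ‖a‖ < 1) (x : H) :
    ‖γ f x - a • x‖ ≤ ‖γ‖ * ‖x - starRingEnd ℂ a • γ f x‖ := by
  obtain ⟨g, hg, h⟩ := A.exists_norm_le_one_mul_one_sub_smul hA f hf ha
  have hx : γ g (x - starRingEnd ℂ a • γ f x) = γ f x - a • x := by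
    have := congrArg (fun T : H →L[ℂ] H => T x) (congrArg γ h)
    rw [hmul, map_sub, map_sub, map_smul, map_smul, hone] at this
    simpa using this
  rw [← hx]
  refine ((γ g).le_opNorm _).trans ?_
  gcongr
  exact γ.unit_le_opNorm g hg

/-- **Proposition (orthogonality of extremal pairs).**
If `(f₀, x₀)` is an extremal pair for a unital bounded homomorphism
`γ : A → L(H)` from a unital uniform algebra `A ⊆ C(K, ℂ)`, then
`(‖γ‖² − 1) ⟨γ(f₀)x₀, x₀⟩ = 0`; in particular if `‖γ‖ > 1` then
`⟨γ(f₀)x₀, x₀⟩ = 0`. -/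
theorem stmt_0 {K : Type*} [TopologicalSpace K] [CompactSpace K] [T2Space K]
    (A : Subalgebra ℂ C(K, ℂ)) (hA : IsClosed (A : Set C(K, ℂ)))
    {H : Type*} [NormedAddCommGroup H] [InnerProductSpace ℂ H]
    (γ : ↥A →L[ℂ] (H →L[ℂ] H))
    (hmul : ∀ f g : ↥A, γ (f * g) = γ f * γ g) (hone : γ 1 = 1)
    (f₀ : ↥A) (x₀ : H) (hf₀ : ‖f₀‖ = 1) (hx₀ : ‖x₀‖ = 1)
    (hext : ‖γ f₀ x₀‖ = ‖γ‖) :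
    ((‖γ‖ : ℂ) ^ 2 - 1) * ⟪x₀, γ f₀ x₀⟫_ℂ = 0 ∧
      (1 < ‖γ‖ → ⟪x₀, γ f₀ x₀⟫_ℂ = 0) := by
  have hγ : 1 ≤ ‖γ‖ := by
    have h1 : ‖(1 : A)‖ ≤ 1 :=
      (ContinuousMap.norm_le (1 : C(K, ℂ)) zero_le_one).2 fun k => by simp
    have h2 := (γ 1).le_of_opNorm_le (γ.unit_le_opNorm 1 h1) x₀
    simpa [hone, hx₀] using h2
  have horth : 1 < ‖γ‖ → ⟪x₀, γ f₀ x₀⟫_ℂ = 0 := by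
    intro hlt
    by_contra hz
    set z := ⟪x₀, γ f₀ x₀⟫_ℂ with hzdef
    set M := ‖γ‖ with hM
    have hzM : ‖z‖ ≤ M := by
      simpa [hx₀, hext] using norm_inner_le_norm (𝕜 := ℂ) x₀ (γ f₀ x₀)
    have hSpos : 0 < ‖z‖ ^ 2 := by positivity
    obtain ⟨t, ht⟩ : ∃ t : ℝ, t * (M ^ 2 + 1) = 1 := ⟨(M ^ 2 + 1)⁻¹, by field_simp⟩
    have htpos : 0 < t := pos_of_mul_pos_left (ht ▸ one_pos) (by positivity)
    have hnorm : ‖(t : ℂ) * z‖ = t * ‖z‖ := by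
      rw [norm_mul, Complex.norm_real, Real.norm_of_nonneg htpos.le]
    have ha : ‖(t : ℂ) * z‖ < 1 := by
      rw [hnorm]
      nlinarith [mul_le_mul_of_nonneg_left hzM htpos.le]
    have key := A.norm_apply_sub_smul_le hA γ hmul hone f₀ hf₀.le ha x₀
    have hzz : starRingEnd ℂ z * z = ((‖z‖ ^ 2 : ℝ) : ℂ) := by
      rw [Complex.conj_mul']; norm_cast
    have e1 : ‖γ f₀ x₀ - ((t : ℂ) * z) • x₀‖ ^ 2
        = M ^ 2 - 2 * (t * ‖z‖ ^ 2) + t ^ 2 * ‖z‖ ^ 2 := by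
      rw [norm_sub_sq (𝕜 := ℂ), norm_smul, hnorm, hx₀, hext, inner_smul_right,
        ← inner_conj_symm, ← hzdef, mul_assoc, mul_comm z, hzz, ← Complex.ofReal_mul]
      simp only [RCLike.re_to_complex, Complex.ofReal_re]
      ring
    have e2 : ‖x₀ - starRingEnd ℂ ((t : ℂ) * z) • γ f₀ x₀‖ ^ 2
        = 1 - 2 * (t * ‖z‖ ^ 2) + t ^ 2 * ‖z‖ ^ 2 * M ^ 2 := by
      rw [norm_sub_sq (𝕜 := ℂ), norm_smul, RCLike.norm_conj, hnorm, hx₀, hext, inner_smul_right,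
        ← hzdef, map_mul (starRingEnd ℂ), Complex.conj_ofReal, mul_assoc, hzz, ← Complex.ofReal_mul]
      simp only [RCLike.re_to_complex, Complex.ofReal_re]
      ring
    have hsq := pow_le_pow_left₀ (norm_nonneg _) key 2
    rw [mul_pow, e1, e2] at hsq
    have hprod : 0 < t * ‖z‖ ^ 2 * (M ^ 2 - 1) :=
      mul_pos (mul_pos htpos hSpos) (by nlinarith)
    have hid : t ^ 2 * ‖z‖ ^ 2 * (M ^ 2 * M ^ 2 - 1) = t * ‖z‖ ^ 2 * (M ^ 2 - 1) := by
      linear_combination t * ‖z‖ ^ 2 * (M ^ 2 - 1) * ht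
    nlinarith
  refine ⟨?_, horth⟩
  rcases hγ.eq_or_lt with h | h
  · simp [← h]
  · rw [horth h, mul_zero]
end

section
/- Let M be a bounded linear operator on a complex Hilbert space H. If x₀ is a unit vector in H on which M attains its norm, that is ‖M x₀‖ = ‖M‖, then M* M x₀ = ‖M‖² • x₀. -/
/-- **Lemma.** If a bounded operator `M` on a complex Hilbert space attains
its norm at a unit vector `x₀`, then `M* M x₀ = ‖M‖² x₀`. -/
theorem stmt_1 {H : Type*} [NormedAddCommGroup H] [InnerProductSpace ℂ H]
    [CompleteSpace H] (M : H →L[ℂ] H) (x₀ : H) (hx₀ : ‖x₀‖ = 1)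
    (hext : ‖M x₀‖ = ‖M‖) :
    ContinuousLinearMap.adjoint M (M x₀) = (‖M‖ ^ 2 : ℝ) • x₀ := by
  have hy : ‖ContinuousLinearMap.adjoint M (M x₀)‖ ≤ ‖M‖ ^ 2 := by
    have h := (ContinuousLinearMap.adjoint M).le_opNorm (M x₀)
    rwa [LinearIsometryEquiv.norm_map, hext, ← sq] at h
  have hinner : (inner ℂ (ContinuousLinearMap.adjoint M (M x₀)) x₀).re = ‖M‖ ^ 2 := by
    rw [ContinuousLinearMap.adjoint_inner_left, ← hext]
    exact inner_self_eq_norm_sq (𝕜 := ℂ) (M x₀)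
  rw [← sub_eq_zero, ← norm_eq_zero, ← sq_eq_zero_iff, ← Complex.coe_smul]
  refine le_antisymm ?_ (sq_nonneg _)
  rw [norm_sub_sq (𝕜 := ℂ), inner_smul_right, norm_smul, hx₀, RCLike.re_eq_complex_re,
    Complex.re_ofReal_mul, hinner, Complex.norm_real, mul_one, Real.norm_eq_abs, sq_abs]
  nlinarith [pow_le_pow_left₀ (norm_nonneg _) hy 2]
end

section
/- Let (f₀, x₀) be an extremal pair for γ. Then the unital linear functional ω : A → ℂ defined by ω(f) = ⟨γ(f)x₀, x₀⟩ is contractive: for every f ∈ A with ‖f‖ ≤ 1 one has |⟨γ(f)x₀, x₀⟩| ≤ 1. -/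
open scoped InnerProductSpace

/-- If `T` is bounded by `M` and attains this bound at the vector `x`, then `T* T x = M² x`, stated
weakly so that no adjoint (hence no completeness) is needed. -/
theorem inner_map_map_eq_of_norm_map_eq {E F : Type*}
    [SeminormedAddCommGroup E] [InnerProductSpace ℂ E]
    [SeminormedAddCommGroup F] [InnerProductSpace ℂ F] (T : E →ₗ[ℂ] F) {M : ℝ}
    (hT : ∀ y, ‖T y‖ ≤ M * ‖y‖) {x : E} (hx : ‖T x‖ = M * ‖x‖) (y : E) :
    ⟪T x, T y⟫_ℂ = (M : ℂ) ^ 2 * ⟪x, y⟫_ℂ := by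
  set b : ℂ := (M : ℂ) ^ 2 * ⟪x, y⟫_ℂ - ⟪T x, T y⟫_ℂ with hb
  set q : ℝ := M ^ 2 * ‖y‖ ^ 2 - ‖T y‖ ^ 2 with hq
  have sq_le (v : E) : ‖T v‖ ^ 2 ≤ M ^ 2 * ‖v‖ ^ 2 := by
    rw [← mul_pow]
    exact pow_le_pow_left₀ (norm_nonneg _) (hT v) 2
  have form_nonneg (z : ℂ) : 0 ≤ 2 * (z * b).re + ‖z‖ ^ 2 * q := by
    have h := sq_le (x + z • y)
    rw [map_add, map_smul, norm_add_sq (𝕜 := ℂ), norm_add_sq (𝕜 := ℂ), inner_smul_right,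
      inner_smul_right, norm_smul, norm_smul, hx] at h
    have hre : (z * b).re = M ^ 2 * (z * ⟪x, y⟫_ℂ).re - (z * ⟪T x, T y⟫_ℂ).re := by
      rw [hb, mul_sub, Complex.sub_re, mul_left_comm, ← Complex.ofReal_pow, Complex.re_ofReal_mul]
    simp only [RCLike.re_to_complex] at h
    rw [hre, hq]
    linarith
  have hq0 : 0 ≤ q := sub_nonneg.2 (sq_le y)
  have key := form_nonneg (-((1 / (q + 1) : ℝ) : ℂ) * (starRingEnd ℂ) b)
  have hre : (-((1 / (q + 1) : ℝ) : ℂ) * (starRingEnd ℂ) b * b).re = -(1 / (q + 1)) * ‖b‖ ^ 2 := by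
    rw [mul_assoc, Complex.conj_mul', ← Complex.ofReal_neg, Complex.re_ofReal_mul,
      ← Complex.ofReal_pow, Complex.ofReal_re]
  rw [hre, norm_mul, norm_neg, Complex.norm_real, RCLike.norm_conj, mul_pow, Real.norm_eq_abs,
    sq_abs] at key
  have hfac : 2 * (-(1 / (q + 1)) * ‖b‖ ^ 2) + (1 / (q + 1)) ^ 2 * ‖b‖ ^ 2 * q
      = -(‖b‖ ^ 2 * ((q + 2) / (q + 1) ^ 2)) := by
    field_simp
    ring
  rw [hfac] at key
  have hpos : 0 < (q + 2) / (q + 1) ^ 2 := by positivity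
  have hb0 : ‖b‖ ^ 2 ≤ 0 := nonpos_of_mul_nonpos_left (by linarith) hpos
  have : b = 0 := by
    rw [← norm_eq_zero (a := b)]
    exact pow_eq_zero_iff two_ne_zero |>.1 (le_antisymm hb0 (sq_nonneg _))
  exact (sub_eq_zero.1 this).symm

/-- **Proposition (contractivity of the extremal state).**
If `(f₀, x₀)` is an extremal pair for the unital bounded homomorphism
`γ : A → L(H)`, then the unital functional `ω(f) = ⟨γ(f)x₀, x₀⟩` is
contractive: `|⟨γ(f)x₀, x₀⟩| ≤ 1` whenever `‖f‖ ≤ 1`. -/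
theorem stmt_2 {K : Type*} [TopologicalSpace K] [CompactSpace K] [T2Space K]
    (A : Subalgebra ℂ C(K, ℂ)) (hA : IsClosed (A : Set C(K, ℂ)))
    {H : Type*} [NormedAddCommGroup H] [InnerProductSpace ℂ H]
    (γ : ↥A →L[ℂ] (H →L[ℂ] H))
    (hmul : ∀ f g : ↥A, γ (f * g) = γ f * γ g) (hone : γ 1 = 1)
    (f₀ : ↥A) (x₀ : H) (hf₀ : ‖f₀‖ = 1) (hx₀ : ‖x₀‖ = 1)
    (hext : ‖γ f₀ x₀‖ = ‖γ‖) :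
    ∀ f : ↥A, ‖f‖ ≤ 1 → ‖⟪x₀, γ f x₀⟫_ℂ‖ ≤ 1 := by
  intro f hf
  have apply_le (g : A) (hg : ‖g‖ ≤ 1) (y : H) : ‖γ g y‖ ≤ ‖γ‖ * ‖y‖ :=
    (γ g).le_of_opNorm_le (by simpa using γ.le_of_opNorm_le_of_le le_rfl hg) y
  have hγ : 0 < ‖γ‖ := by
    refine (norm_nonneg γ).lt_of_ne fun h ↦ ?_
    have h_one : ‖γ 1 x₀‖ ≤ ‖γ 1‖ * ‖x₀‖ := (γ 1).le_opNorm x₀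
    have h_zero : ‖γ 1‖ ≤ ‖γ‖ * ‖(1 : A)‖ := γ.le_opNorm 1
    rw [← h, zero_mul] at h_zero
    rw [hx₀, mul_one] at h_one
    have h_id : γ 1 x₀ = x₀ := by rw [hone, one_apply_eq_self]
    rw [h_id, hx₀] at h_one
    linarith
  have hgf : ‖f₀ * f‖ ≤ 1 :=
    (norm_mul_le _ _).trans (by rwa [hf₀, one_mul])
  have hinner := inner_map_map_eq_of_norm_map_eq (γ f₀ : H →ₗ[ℂ] H) (M := ‖γ‖)
    (apply_le f₀ hf₀.le) (x := x₀) (by simpa [hx₀] using hext) (γ f x₀)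
  have hle : ‖γ‖ ^ 2 * ‖⟪x₀, γ f x₀⟫_ℂ‖ ≤ ‖γ‖ ^ 2 * 1 := calc
    ‖γ‖ ^ 2 * ‖⟪x₀, γ f x₀⟫_ℂ‖ = ‖(‖γ‖ : ℂ) ^ 2 * ⟪x₀, γ f x₀⟫_ℂ‖ := by simp
    _ = ‖⟪γ f₀ x₀, γ (f₀ * f) x₀⟫_ℂ‖ := by
      rw [← hinner, hmul]
      rfl
    _ ≤ ‖γ f₀ x₀‖ * ‖γ (f₀ * f) x₀‖ := norm_inner_le_norm _ _
    _ ≤ ‖γ‖ * (‖γ‖ * ‖x₀‖) := by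
      rw [hext]
      gcongr
      exact apply_le _ hgf x₀
    _ = ‖γ‖ ^ 2 * 1 := by rw [hx₀]; ring
  exact le_of_mul_le_mul_left hle (by positivity)
end

section
/- Let (f₀, x₀) be an extremal pair for γ. Then there exists a Borel probability measure μ on K such that ⟨γ(f)x₀, x₀⟩ = ∫_K f(z) dμ(z) for all f ∈ A. -/
open scoped InnerProductSpace

open Filter Topology MeasureTheory

/-- A positive real-linear functional on `C(K, ℂ)`, positivity being tested on functions with
nonnegative real part, is given by integrating the real part against a finite measure. -/
theorem exists_measure_of_re_nonneg {K : Type*} [TopologicalSpace K] [CompactSpace K] [T2Space K]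
    [MeasurableSpace K] [BorelSpace K] (g : C(K, ℂ) →ₗ[ℝ] ℝ)
    (hg : ∀ f : C(K, ℂ), (∀ z, 0 ≤ (f z).re) → 0 ≤ g f) :
    ∃ μ : Measure K, IsFiniteMeasure μ ∧ ∀ f : C(K, ℂ), g f = ∫ z, (f z).re ∂μ := by
  let ofRe : CompactlySupportedContinuousMap K ℝ →ₗ[ℝ] C(K, ℂ) :=
    { toFun := fun h => ⟨fun z => (h z : ℂ), Complex.continuous_ofReal.comp h.continuous⟩
      map_add' := fun _ _ => by ext; simp
      map_smul' := fun _ _ => by ext; simp }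
  let Λ : CompactlySupportedContinuousMap K ℝ →ₚ[ℝ] ℝ :=
    PositiveLinearMap.mk₀ (g.comp ofRe) fun h hh => hg _ fun z => by simpa [ofRe] using hh z
  refine ⟨RealRMK.rieszMeasure Λ, inferInstance, fun f => ?_⟩
  let h : CompactlySupportedContinuousMap K ℝ :=
    ⟨⟨fun z => (f z).re, Complex.continuous_re.comp f.continuous⟩,
      HasCompactSupport.of_compactSpace _⟩
  have hΛ : ∫ z, (f z).re ∂(RealRMK.rieszMeasure Λ) = g (ofRe h) :=
    RealRMK.integral_rieszMeasure Λ h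
  have hre : ∀ z, (ofRe h z).re = (f z).re := fun z => Complex.ofReal_re _
  have h₁ := hg (f - ofRe h) fun z => by simp [hre]
  have h₂ := hg (ofRe h - f) fun z => by simp [hre]
  rw [map_sub] at h₁ h₂
  rw [hΛ]
  linarith

/-- A unital linear functional on a subalgebra of `C(K, ℂ)` that maps functions with nonnegative
real part to numbers with nonnegative real part is represented by a probability measure. -/
theorem exists_probabilityMeasure_of_re_nonneg {K : Type*} [TopologicalSpace K] [CompactSpace K]
    [T2Space K] [MeasurableSpace K] [BorelSpace K] (A : Subalgebra ℂ C(K, ℂ))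
    (L : ↥A →ₗ[ℂ] ℂ) (hone : L 1 = 1)
    (hpos : ∀ f : ↥A, (∀ z, 0 ≤ ((f : C(K, ℂ)) z).re) → 0 ≤ (L f).re) :
    ∃ μ : Measure K, IsProbabilityMeasure μ ∧ ∀ f : ↥A, L f = ∫ z, (f : C(K, ℂ)) z ∂μ := by
  let C : PointedCone ℝ C(K, ℂ) :=
    { carrier := {f | ∀ z, 0 ≤ (f z).re}
      add_mem' := fun ha hb z => by simpa using add_nonneg (ha z) (hb z)
      zero_mem' := fun z => by simp
      smul_mem' := fun c f hf z => by
        have : (((c : ℝ) • f z : ℂ)).re = (c : ℝ) * (f z).re := Complex.smul_re _ _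
        exact this.symm ▸ mul_nonneg c.2 (hf z) }
  let φ : C(K, ℂ) →ₗ.[ℝ] ℝ :=
    { domain := (Subalgebra.toSubmodule A).restrictScalars ℝ
      toFun := Complex.reLm.comp (L.restrictScalars ℝ) }
  obtain ⟨g, hgφ, hg⟩ := riesz_extension C φ (fun x hx => hpos x hx) fun y =>
    ⟨⟨algebraMap ℂ C(K, ℂ) (‖y‖ : ℂ), A.algebraMap_mem _⟩, fun z => by
      have := (abs_le.1 ((Complex.abs_re_le_norm (y z)).trans (y.norm_coe_le_norm z))).1
      simp
      linarith⟩
  have hgL (f : ↥A) : g f = (L f).re := hgφ ⟨f, f.2⟩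
  obtain ⟨μ, hμ, hgμ⟩ := exists_measure_of_re_nonneg g hg
  have hre (f : ↥A) : (L f).re = ∫ z, ((f : C(K, ℂ)) z).re ∂μ := by rw [← hgL, hgμ]
  refine ⟨μ, ⟨?_⟩, fun f => ?_⟩
  · have h := hre 1
    simp only [hone, Complex.one_re, OneMemClass.coe_one, ContinuousMap.one_apply, integral_const,
      smul_eq_mul, mul_one] at h
    rw [← ENNReal.toReal_eq_one_iff]
    exact h.symm
  · have hint : Integrable (fun z => (f : C(K, ℂ)) z) μ :=
      (f : C(K, ℂ)).continuous.integrable_of_hasCompactSupport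
        (HasCompactSupport.of_compactSpace _)
    have him := hre ((-Complex.I) • f)
    simp only [map_smul, SetLike.val_smul, ContinuousMap.smul_apply, smul_eq_mul, Complex.mul_re,
      Complex.neg_re, Complex.I_re, Complex.I_im, zero_mul, zero_sub,
      neg_mul, one_mul, neg_neg] at him
    apply Complex.ext
    · rw [hre]
      exact integral_re hint
    · rw [him]
      exact integral_im hint

/-- If `(f₀, x₀)` is an extremal pair for `γ` and `f` has nonnegative real part, then the
perturbed vector `x₀ + t • γ f x₀` is at least as long as `x₀` for small `t ≥ 0`. -/
theorem one_le_norm_add_smul_of_extremal {K : Type*} [TopologicalSpace K] [CompactSpace K]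
    (A : Subalgebra ℂ C(K, ℂ)) (hA : IsClosed (A : Set C(K, ℂ)))
    {H : Type*} [NormedAddCommGroup H] [InnerProductSpace ℂ H]
    (γ : ↥A →L[ℂ] (H →L[ℂ] H))
    (hmul : ∀ f g : ↥A, γ (f * g) = γ f * γ g) (hone : γ 1 = 1)
    (f₀ : ↥A) (x₀ : H) (hf₀ : ‖f₀‖ = 1) (hx₀ : ‖x₀‖ = 1) (hext : ‖γ f₀ x₀‖ = ‖γ‖)
    (f : ↥A) (hf : ∀ z, 0 ≤ ((f : C(K, ℂ)) z).re) (t : ℝ) (ht : 0 ≤ t) (htf : t * ‖f‖ < 1) :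
    1 ≤ ‖x₀ + (t : ℂ) • γ f x₀‖ := by
  have : CompleteSpace ↥A := hA.completeSpace_coe
  have hγ : 0 < ‖γ‖ := by
    refine (norm_nonneg γ).lt_of_ne' fun h => ?_
    have h₁ := γ.le_opNorm 1
    have h₂ := (γ 1).le_opNorm x₀
    rw [h, zero_mul] at h₁
    rw [hx₀, hone, one_apply_eq_self, hx₀, ← hone] at h₂
    linarith
  let u : (↥A)ˣ := Units.oneSub (-((t : ℂ) • f)) (by
    rwa [norm_neg, norm_smul, Complex.norm_real, Real.norm_of_nonneg ht])
  have hu : (u : ↥A) = 1 + (t : ℂ) • f := by simp [u]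
  have hux : γ u x₀ = x₀ + (t : ℂ) • γ f x₀ := by simp [hu, hone]
  have hinv (z : K) : ‖((↑u⁻¹ : ↥A) : C(K, ℂ)) z‖ ≤ 1 := by
    have h : ((u : ↥A) : C(K, ℂ)) z * ((↑u⁻¹ : ↥A) : C(K, ℂ)) z = 1 := by
      exact congrArg (fun a : ↥A => (a : C(K, ℂ)) z) u.mul_inv
    have hre : 1 ≤ ‖((u : ↥A) : C(K, ℂ)) z‖ := by
      refine le_trans ?_ (Complex.re_le_norm _)
      simpa [hu] using mul_nonneg ht (hf z)
    have h' := congrArg norm h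
    rw [norm_mul, norm_one] at h'
    nlinarith [norm_nonneg (((↑u⁻¹ : ↥A) : C(K, ℂ)) z)]
  have hfu : ‖f₀ * ↑u⁻¹‖ ≤ 1 := by
    refine (norm_mul_le _ _).trans ?_
    rw [hf₀, one_mul]
    exact (ContinuousMap.norm_le _ zero_le_one).2 hinv
  have hfac : γ f₀ x₀ = γ (f₀ * ↑u⁻¹) (γ u x₀) := by
    rw [← mul_apply_eq_comp, ← hmul, mul_assoc, Units.inv_mul, mul_one]
  have hle : ‖γ‖ * 1 ≤ ‖γ‖ * ‖γ u x₀‖ := by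
    calc ‖γ‖ * 1 = ‖γ (f₀ * ↑u⁻¹) (γ u x₀)‖ := by rw [mul_one, ← hext, hfac]
      _ ≤ ‖γ (f₀ * ↑u⁻¹)‖ * ‖γ u x₀‖ := ContinuousLinearMap.le_opNorm _ _
      _ ≤ ‖γ‖ * ‖γ u x₀‖ := by
        gcongr
        exact (γ.le_opNorm _).trans (mul_le_of_le_one_right hγ.le hfu)
  rw [← hux]
  exact le_of_mul_le_mul_left hle hγ

/-- If `(f₀, x₀)` is an extremal pair for `γ` and `f` has nonnegative real part, then so does
`⟨γ(f)x₀, x₀⟩`. -/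
theorem re_inner_nonneg_of_extremal {K : Type*} [TopologicalSpace K] [CompactSpace K]
    (A : Subalgebra ℂ C(K, ℂ)) (hA : IsClosed (A : Set C(K, ℂ)))
    {H : Type*} [NormedAddCommGroup H] [InnerProductSpace ℂ H]
    (γ : ↥A →L[ℂ] (H →L[ℂ] H))
    (hmul : ∀ f g : ↥A, γ (f * g) = γ f * γ g) (hone : γ 1 = 1)
    (f₀ : ↥A) (x₀ : H) (hf₀ : ‖f₀‖ = 1) (hx₀ : ‖x₀‖ = 1) (hext : ‖γ f₀ x₀‖ = ‖γ‖)
    (f : ↥A) (hf : ∀ z, 0 ≤ ((f : C(K, ℂ)) z).re) :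
    0 ≤ (⟪x₀, γ f x₀⟫_ℂ).re := by
  have hlim : Tendsto (fun t : ℝ => 2 * (⟪x₀, γ f x₀⟫_ℂ).re + t * ‖γ f x₀‖ ^ 2) (𝓝[>] 0)
      (𝓝 (2 * (⟪x₀, γ f x₀⟫_ℂ).re)) := by
    refine Tendsto.mono_left ?_ nhdsWithin_le_nhds
    exact Continuous.tendsto' (by fun_prop) _ _ (by simp)
  have hsmall : ∀ᶠ t : ℝ in 𝓝[>] 0, t * ‖f‖ < 1 :=
    nhdsWithin_le_nhds <|
      ((by fun_prop : Continuous fun t : ℝ => t * ‖f‖).tendsto' 0 0 (zero_mul _)).eventually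
        (gt_mem_nhds one_pos)
  have hnonneg := ge_of_tendsto (b := 0) hlim (by
    filter_upwards [hsmall, self_mem_nhdsWithin] with t htf ht
    have ht : 0 < t := ht
    have h := one_le_norm_add_smul_of_extremal A hA γ hmul hone f₀ x₀ hf₀ hx₀ hext f hf t ht.le htf
    have hexp := norm_add_sq (𝕜 := ℂ) x₀ ((t : ℂ) • γ f x₀)
    rw [inner_smul_right, norm_smul, Complex.norm_real, Real.norm_of_nonneg ht.le, hx₀,
      RCLike.re_to_complex, Complex.re_ofReal_mul] at hexp
    have : 0 ≤ t * (2 * (⟪x₀, γ f x₀⟫_ℂ).re + t * ‖γ f x₀‖ ^ 2) := by nlinarith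
    exact nonneg_of_mul_nonneg_right this ht)
  linarith

/-- **Proposition (existence of extremal measures).**
If `(f₀, x₀)` is an extremal pair for the unital bounded homomorphism
`γ : A → L(H)`, then there exists a Borel probability measure `μ` on `K`
with `⟨γ(f)x₀, x₀⟩ = ∫_K f dμ` for all `f ∈ A`. -/
theorem stmt_3 {K : Type*} [TopologicalSpace K] [CompactSpace K] [T2Space K]
    [MeasurableSpace K] [BorelSpace K]
    (A : Subalgebra ℂ C(K, ℂ)) (hA : IsClosed (A : Set C(K, ℂ)))
    {H : Type*} [NormedAddCommGroup H] [InnerProductSpace ℂ H]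
    (γ : ↥A →L[ℂ] (H →L[ℂ] H))
    (hmul : ∀ f g : ↥A, γ (f * g) = γ f * γ g) (hone : γ 1 = 1)
    (f₀ : ↥A) (x₀ : H) (hf₀ : ‖f₀‖ = 1) (hx₀ : ‖x₀‖ = 1)
    (hext : ‖γ f₀ x₀‖ = ‖γ‖) :
    ∃ μ : MeasureTheory.Measure K, MeasureTheory.IsProbabilityMeasure μ ∧
      ∀ f : ↥A, ⟪x₀, γ f x₀⟫_ℂ = ∫ z, (f : C(K, ℂ)) z ∂μ := by
  let L : ↥A →ₗ[ℂ] ℂ :=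
    (innerSL ℂ x₀).toLinearMap ∘ₗ (ContinuousLinearMap.apply ℂ H x₀).toLinearMap ∘ₗ γ.toLinearMap
  exact exists_probabilityMeasure_of_re_nonneg A L (by simp [L, hone, hx₀])
    fun f hf => re_inner_nonneg_of_extremal A hA γ hmul hone f₀ x₀ hf₀ hx₀ hext f hf
end

section
/- Suppose ‖γ‖ > 1 and (f₀, x₀) is an extremal pair for γ. Set c := (1/2)·inf_{ω ∈ A'} ‖γ_Φ − ω‖, where the infimum is over all bounded linear functionals ω on A. Then ‖γ‖ ≤ c + √( c² + |⟨γ(Φ(f₀)·f₀)x₀, x₀⟩| ), where Φ(f₀)·f₀ denotes the product in A. -/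
open scoped InnerProductSpace

open ComplexConjugate in
/-- Second-order bound for the infinitesimal Möbius perturbation `z ↦ z - a + ā z²` of the
closed unit disc. -/
theorem Complex.sq_norm_moebius_perturbation_le {z a : ℂ} (hz : ‖z‖ ≤ 1) (ha : ‖a‖ ≤ 1 / 2) :
    ‖z - a + conj a * z ^ 2‖ ^ 2 ≤ 1 + 4 * ‖a‖ ^ 2 := by
  have hz2 : ‖z‖ ^ 2 ≤ 1 := pow_le_one₀ (norm_nonneg z) hz
  have hw : ‖conj a * z ^ 2 - a‖ ≤ 2 * ‖a‖ := by
    refine (norm_sub_le _ _).trans ?_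
    rw [norm_mul, norm_pow, RCLike.norm_conj]
    nlinarith [norm_nonneg a]
  have hw2 : ‖conj a * z ^ 2 - a‖ ^ 2 ≤ 4 * ‖a‖ ^ 2 := by
    nlinarith [norm_nonneg (conj a * z ^ 2 - a)]
  have hre : -(1 / 2) ≤ (conj a * z).re := by
    refine (abs_le.mp ((Complex.abs_re_le_norm _).trans ?_)).1
    rw [norm_mul, RCLike.norm_conj]
    nlinarith [norm_nonneg a, norm_nonneg z]
  have key : ‖z - a + conj a * z ^ 2‖ ^ 2
      = ‖z‖ ^ 2 - 2 * (conj a * z).re * (1 - ‖z‖ ^ 2) + ‖conj a * z ^ 2 - a‖ ^ 2 := by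
    simp only [← Complex.normSq_eq_norm_sq]
    simp only [Complex.normSq_apply, pow_two, Complex.add_re,
      Complex.add_im, Complex.sub_re, Complex.sub_im, Complex.mul_re, Complex.mul_im,
      Complex.conj_re, Complex.conj_im]
    ring
  rw [key]
  nlinarith

/-- If a complex number `w` satisfies `Re (a w) ≤ C |a|²` for all small `a`, then `w = 0`. -/
theorem Complex.eq_zero_of_re_mul_le {w : ℂ} {C : ℝ} (hC : 0 ≤ C)
    (h : ∀ a : ℂ, ‖a‖ ≤ 1 / 2 → (a * w).re ≤ C * ‖a‖ ^ 2) : w = 0 := by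
  by_contra hw
  have hpos : 0 < ‖w‖ := norm_pos_iff.mpr hw
  have hden : 0 < 2 * C + 2 * ‖w‖ := by positivity
  set t : ℝ := (2 * C + 2 * ‖w‖)⁻¹ with ht
  have htpos : 0 < t := inv_pos.mpr hden
  have ht1 : t * (2 * C + 2 * ‖w‖) = 1 := inv_mul_cancel₀ hden.ne'
  have hnorm : ‖(t : ℂ) * starRingEnd ℂ w‖ = t * ‖w‖ := by
    rw [norm_mul, RCLike.norm_conj, Complex.norm_real, Real.norm_of_nonneg htpos.le]
  have h1 := h ((t : ℂ) * starRingEnd ℂ w) (by rw [hnorm]; nlinarith)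
  have hre : ((t : ℂ) * starRingEnd ℂ w * w).re = t * ‖w‖ ^ 2 := by
    rw [mul_assoc, Complex.conj_mul']
    norm_cast
  rw [hnorm, hre] at h1
  have h2 : 0 < t * ‖w‖ ^ 2 := by positivity
  have h3 : C * t ≤ 1 / 2 := by nlinarith
  nlinarith

/-- A norm-attaining unit vector `x` of an operator `T` is an eigenvector of `T† T`. -/
theorem ContinuousLinearMap.adjoint_apply_apply_eq_of_norm_attained
    {H : Type*} [NormedAddCommGroup H] [InnerProductSpace ℂ H] [CompleteSpace H]
    (T : H →L[ℂ] H) {x : H} {M : ℝ} (hT : ‖T‖ ≤ M) (hx : ‖x‖ = 1) (hTx : ‖T x‖ = M) :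
    ContinuousLinearMap.adjoint T (T x) = ((M ^ 2 : ℝ) : ℂ) • x := by
  have hM : 0 ≤ M := hTx ▸ norm_nonneg _
  have h1 : ‖ContinuousLinearMap.adjoint T (T x)‖ ≤ M ^ 2 := by
    refine ((ContinuousLinearMap.adjoint T).le_opNorm _).trans ?_
    rw [LinearIsometryEquiv.norm_map, hTx]
    nlinarith
  have h2 : ⟪ContinuousLinearMap.adjoint T (T x), x⟫_ℂ = ((M ^ 2 : ℝ) : ℂ) := by
    rw [ContinuousLinearMap.adjoint_inner_left, inner_self_eq_norm_sq_to_K, hTx]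
    norm_cast
  have h3 := @norm_sub_sq ℂ H _ _ _ (ContinuousLinearMap.adjoint T (T x)) (((M ^ 2 : ℝ) : ℂ) • x)
  rw [inner_smul_right, h2, norm_smul, hx, Complex.norm_real, Real.norm_of_nonneg (by positivity),
    ← Complex.ofReal_mul, RCLike.re_to_complex, Complex.ofReal_re] at h3
  have h4 : ‖ContinuousLinearMap.adjoint T (T x) - ((M ^ 2 : ℝ) : ℂ) • x‖ ^ 2 ≤ 0 := by
    rw [h3]
    nlinarith [norm_nonneg (ContinuousLinearMap.adjoint T (T x))]
  rw [← sub_eq_zero, ← norm_eq_zero]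
  exact pow_eq_zero_iff two_ne_zero |>.mp (le_antisymm h4 (sq_nonneg _))

/-- For a unital bounded homomorphism `γ` with `‖γ‖ > 1` and an extremal pair `(f, x)`, the vectors
`γ(f) x` and `x` are orthogonal. -/
theorem inner_apply_eq_zero_of_extremal_pair {K : Type*} [TopologicalSpace K] [CompactSpace K]
    {A : Subalgebra ℂ C(K, ℂ)}
    {H : Type*} [NormedAddCommGroup H] [InnerProductSpace ℂ H] [CompleteSpace H]
    (γ : ↥A →L[ℂ] (H →L[ℂ] H))
    (hmul : ∀ f g : ↥A, γ (f * g) = γ f * γ g) (hone : γ 1 = 1) (hγ : 1 < ‖γ‖)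
    {f : ↥A} {x : H} (hf : ‖f‖ = 1) (hx : ‖x‖ = 1) (hext : ‖γ f x‖ = ‖γ‖) :
    ⟪γ f x, x⟫_ℂ = 0 := by
  set T := γ f with hT
  set p := ⟪T x, x⟫_ℂ with hp
  set q := ⟪T x, T (T x)⟫_ℂ with hq
  have hTn : ‖T‖ ≤ ‖γ‖ := by simpa [hf] using γ.le_opNorm f
  have hqp : q = ((‖γ‖ ^ 2 : ℝ) : ℂ) * starRingEnd ℂ p := by
    rw [hq, ← ContinuousLinearMap.adjoint_inner_left,
      T.adjoint_apply_apply_eq_of_norm_attained hTn hx hext, inner_smul_left, hp, inner_conj_symm,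
      Complex.conj_ofReal]
  have hvar : ∀ a : ℂ, ‖a‖ ≤ 1 / 2 →
      (a * (starRingEnd ℂ q - p)).re ≤ 2 * ‖γ‖ ^ 2 * ‖a‖ ^ 2 := by
    intro a ha
    set g : ↥A := f - a • 1 + starRingEnd ℂ a • (f * f) with hg
    have hgn : ‖g‖ ≤ √(1 + 4 * ‖a‖ ^ 2) := by
      change ‖(g : C(K, ℂ))‖ ≤ _
      refine (ContinuousMap.norm_le _ (Real.sqrt_nonneg _)).mpr fun k => ?_
      refine Real.le_sqrt_of_sq_le ?_
      have hfk : ‖(f : C(K, ℂ)) k‖ ≤ 1 := ((f : C(K, ℂ)).norm_coe_le_norm k).trans hf.le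
      have := Complex.sq_norm_moebius_perturbation_le hfk ha
      simpa [hg, pow_two] using this
    have hγg : γ g x = T x + (starRingEnd ℂ a • T (T x) - a • x) := by
      simp only [hg, map_add, map_sub, map_smul, hmul, hone, ← hT, add_apply, sub_apply,
        smul_apply, mul_apply_eq_comp, one_apply_eq_self]
      abel
    have hle : ‖γ g x‖ ≤ ‖γ‖ * √(1 + 4 * ‖a‖ ^ 2) := by
      refine (γ g).le_of_opNorm_le_of_le ?_ hx.le |>.trans (mul_one _).le
      exact γ.le_opNorm_of_le hgn
    have hsq : ‖γ g x‖ ^ 2 ≤ ‖γ‖ ^ 2 * (1 + 4 * ‖a‖ ^ 2) := by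
      have := pow_le_pow_left₀ (norm_nonneg _) hle 2
      rwa [mul_pow, Real.sq_sqrt (by positivity)] at this
    rw [hγg, @norm_add_sq ℂ, hext, inner_sub_right, inner_smul_right, inner_smul_right, ← hp, ← hq]
      at hsq
    have hre : RCLike.re (starRingEnd ℂ a * q - a * p) = (a * (starRingEnd ℂ q - p)).re := by
      simp [Complex.mul_re]
      ring
    rw [hre] at hsq
    nlinarith [sq_nonneg ‖starRingEnd ℂ a • T (T x) - a • x‖]
  have h0 := Complex.eq_zero_of_re_mul_le (by positivity) hvar
  rw [hqp, map_mul, Complex.conj_ofReal, Complex.conj_conj, ← sub_one_mul] at h0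
  refine (mul_eq_zero.mp h0).resolve_left ?_
  rw [← Complex.ofReal_one, ← Complex.ofReal_sub]
  exact Complex.ofReal_ne_zero.mpr (by nlinarith)

/-- **Main Theorem.** Let `γ : A → L(H)` be a unital bounded homomorphism with
`‖γ‖ > 1` admitting an extremal pair `(f₀, x₀)`, and let `Φ : A → A` be a
bounded antilinear map with associated map `γ_Φ(f) = γ(f) + γ(Φ(f))*`. With
`c = (1/2) inf_{ω ∈ A'} ‖γ_Φ − ω‖` one has
`‖γ‖ ≤ c + √(c² + |⟨γ(Φ(f₀)f₀)x₀, x₀⟩|)`. -/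
theorem stmt_5 {K : Type*} [TopologicalSpace K] [CompactSpace K] [T2Space K]
    (A : Subalgebra ℂ C(K, ℂ)) (hA : IsClosed (A : Set C(K, ℂ)))
    {H : Type*} [NormedAddCommGroup H] [InnerProductSpace ℂ H] [CompleteSpace H]
    (γ : ↥A →L[ℂ] (H →L[ℂ] H))
    (hmul : ∀ f g : ↥A, γ (f * g) = γ f * γ g) (hone : γ 1 = 1)
    (Φ : ↥A →SL[starRingEnd ℂ] ↥A)
    (γΦ : ↥A →L[ℂ] (H →L[ℂ] H))
    (hγΦ : ∀ f : ↥A, γΦ f = γ f + ContinuousLinearMap.adjoint (γ (Φ f)))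
    (hγ : 1 < ‖γ‖)
    (f₀ : ↥A) (x₀ : H) (hf₀ : ‖f₀‖ = 1) (hx₀ : ‖x₀‖ = 1)
    (hext : ‖γ f₀ x₀‖ = ‖γ‖) :
    ‖γ‖ ≤ (1 / 2 * ⨅ ω : ↥A →L[ℂ] ℂ, ‖γΦ - ω.smulRight (1 : H →L[ℂ] H)‖) +
      Real.sqrt ((1 / 2 * ⨅ ω : ↥A →L[ℂ] ℂ, ‖γΦ - ω.smulRight (1 : H →L[ℂ] H)‖) ^ 2 +
        ‖⟪x₀, γ (Φ f₀ * f₀) x₀⟫_ℂ‖) := by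
  set c : ℝ := 1 / 2 * ⨅ ω : ↥A →L[ℂ] ℂ, ‖γΦ - ω.smulRight (1 : H →L[ℂ] H)‖ with hc
  set d : ℝ := ‖⟪x₀, γ (Φ f₀ * f₀) x₀⟫_ℂ‖ with hd
  have hpos : 0 < ‖γ‖ := by linarith
  have horth := inner_apply_eq_zero_of_extremal_pair γ hmul hone hγ hf₀ hx₀ hext
  have hbound (ω : ↥A →L[ℂ] ℂ) :
      (‖γ‖ ^ 2 - d) / ‖γ‖ ≤ ‖γΦ - ω.smulRight (1 : H →L[ℂ] H)‖ := by
    set R := γΦ - ω.smulRight (1 : H →L[ℂ] H) with hR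
    have hRx : R f₀ x₀
        = γ f₀ x₀ + ContinuousLinearMap.adjoint (γ (Φ f₀)) x₀ - ω f₀ • x₀ := by
      simp [hR, hγΦ]
    have hinner : ⟪R f₀ x₀, γ f₀ x₀⟫_ℂ
        = ((‖γ‖ ^ 2 : ℝ) : ℂ) + ⟪x₀, γ (Φ f₀ * f₀) x₀⟫_ℂ := by
      rw [hRx, inner_sub_left, inner_add_left, inner_smul_left, inner_eq_zero_symm.mp horth,
        ContinuousLinearMap.adjoint_inner_left, inner_self_eq_norm_sq_to_K, hext, hmul]
      simp
    have hup : ‖⟪R f₀ x₀, γ f₀ x₀⟫_ℂ‖ ≤ ‖R‖ * ‖γ‖ := by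
      refine (norm_inner_le_norm _ _).trans ?_
      rw [hext]
      gcongr
      refine ((R f₀).le_opNorm x₀).trans ?_
      simpa [hf₀, hx₀] using R.le_opNorm f₀
    have hlow : ‖γ‖ ^ 2 - d ≤ ‖⟪R f₀ x₀, γ f₀ x₀⟫_ℂ‖ := by
      have := norm_sub_le_norm_add ((‖γ‖ ^ 2 : ℝ) : ℂ) ⟪x₀, γ (Φ f₀ * f₀) x₀⟫_ℂ
      rwa [← hinner, Complex.norm_real, Real.norm_of_nonneg (by positivity)] at this
    rw [div_le_iff₀ hpos]
    exact hlow.trans hup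
  have hinf : (‖γ‖ ^ 2 - d) / ‖γ‖ ≤ 2 * c := by
    rw [hc, ← mul_assoc, mul_one_div_cancel two_ne_zero, one_mul]
    exact le_ciInf hbound
  rw [div_le_iff₀ hpos] at hinf
  have : ‖γ‖ - c ≤ √(c ^ 2 + d) := Real.le_sqrt_of_sq_le (by nlinarith)
  linarith
end

section
/- Suppose ‖γ‖ > 1 and (f₀, x₀) is an extremal pair for γ. Then for every bounded linear functional ω on A, ‖γ‖² ≤ ‖γ‖·‖γ_Φ − ω‖ + |⟨γ(Φ(f₀)·f₀)x₀, x₀⟩|, where Φ(f₀)·f₀ denotes the product in A. -/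
open scoped InnerProductSpace

/-- On the closed unit disc, the first-order expansion in `a` of the Möbius map
`z ↦ (z - a) / (1 - conj a * z)` has modulus at most `1` up to an error quadratic in `a`. -/
lemma norm_sq_mobius_expansion_le {z a : ℂ} (hz : ‖z‖ ≤ 1) (ha : ‖a‖ ≤ 1 / 2) :
    ‖z + (starRingEnd ℂ a * (z * z) - a)‖ ^ 2 ≤ 1 + 4 * ‖a‖ ^ 2 := by
  have hw : ‖starRingEnd ℂ a * (z * z) - a‖ ≤ 2 * ‖a‖ := by
    calc ‖starRingEnd ℂ a * (z * z) - a‖ ≤ ‖starRingEnd ℂ a * (z * z)‖ + ‖a‖ := norm_sub_le _ _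
      _ = ‖a‖ * (‖z‖ * ‖z‖) + ‖a‖ := by simp
      _ ≤ ‖a‖ * 1 + ‖a‖ := by gcongr; nlinarith [norm_nonneg z]
      _ = 2 * ‖a‖ := by ring
  have hcross : (⟪z, starRingEnd ℂ a * (z * z) - a⟫_ℂ).re
      = -(1 - ‖z‖ ^ 2) * (a * starRingEnd ℂ z).re := by
    simp only [RCLike.inner_apply, Complex.sq_norm, Complex.normSq_apply, Complex.mul_re,
      Complex.mul_im, Complex.sub_re, Complex.sub_im, Complex.conj_re, Complex.conj_im]
    ring
  have hre : -(1 / 2) ≤ (a * starRingEnd ℂ z).re := by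
    have h := (abs_le.mp (Complex.abs_re_le_norm (a * starRingEnd ℂ z))).1
    rw [norm_mul, RCLike.norm_conj] at h
    nlinarith [norm_nonneg z, norm_nonneg a]
  have hexp := norm_add_sq (𝕜 := ℂ) z (starRingEnd ℂ a * (z * z) - a)
  rw [RCLike.re_eq_complex_re, hcross] at hexp
  have hw2 : ‖starRingEnd ℂ a * (z * z) - a‖ ^ 2 ≤ (2 * ‖a‖) ^ 2 := by gcongr
  have hz2 : 0 ≤ 1 - ‖z‖ ^ 2 := by nlinarith [norm_nonneg z]
  nlinarith [mul_nonneg hz2 (by linarith : 0 ≤ (a * starRingEnd ℂ z).re + 1 / 2)]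

/-- If `‖T‖ ≤ M` and `T` stretches the unit vector `x` by exactly `M`, then `T* T x = M² x`. -/
lemma adjoint_apply_apply_of_norm_attained {H : Type*} [NormedAddCommGroup H]
    [InnerProductSpace ℂ H] [CompleteSpace H] {T : H →L[ℂ] H} {M : ℝ} {x : H}
    (hT : ‖T‖ ≤ M) (hx : ‖x‖ = 1) (hTx : ‖T x‖ = M) :
    ContinuousLinearMap.adjoint T (T x) = ((M ^ 2 : ℝ) : ℂ) • x := by
  have hM : 0 ≤ M := (norm_nonneg _).trans hT
  have hnorm : ‖ContinuousLinearMap.adjoint T (T x)‖ ≤ M * M := by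
    calc _ ≤ ‖ContinuousLinearMap.adjoint T‖ * ‖T x‖ := ContinuousLinearMap.le_opNorm _ _
      _ = ‖T‖ * M := by rw [LinearIsometryEquiv.norm_map, hTx]
      _ ≤ M * M := by gcongr
  have hcross : RCLike.re ⟪ContinuousLinearMap.adjoint T (T x), ((M ^ 2 : ℝ) : ℂ) • x⟫_ℂ
      = M ^ 2 * M ^ 2 := by
    rw [inner_smul_right, ContinuousLinearMap.adjoint_inner_left, inner_self_eq_norm_sq_to_K, hTx,
      RCLike.re_eq_complex_re, Complex.re_ofReal_mul]
    congr 1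
    norm_cast
  have hexp := norm_sub_sq (𝕜 := ℂ) (ContinuousLinearMap.adjoint T (T x)) (((M ^ 2 : ℝ) : ℂ) • x)
  rw [hcross, norm_smul, hx, Complex.norm_real, Real.norm_of_nonneg (sq_nonneg M)] at hexp
  have hsq : ‖ContinuousLinearMap.adjoint T (T x)‖ ^ 2 ≤ (M * M) ^ 2 := by gcongr
  rw [← sub_eq_zero, ← norm_eq_zero, ← sq_eq_zero_iff]
  exact le_antisymm (by nlinarith) (sq_nonneg _)

/-- For an extremal pair `(f₀, x₀)` of a bounded homomorphism `γ` with `‖γ‖ > 1`, the vectors `x₀`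
and `γ(f₀) x₀` are orthogonal. -/
lemma inner_extremal_eq_zero {K : Type*} [TopologicalSpace K] [CompactSpace K]
    {A : Subalgebra ℂ C(K, ℂ)}
    {H : Type*} [NormedAddCommGroup H] [InnerProductSpace ℂ H] [CompleteSpace H]
    {γ : ↥A →L[ℂ] (H →L[ℂ] H)}
    (hmul : ∀ f g : ↥A, γ (f * g) = γ f * γ g) (hone : γ 1 = 1) (hγ : 1 < ‖γ‖)
    {f₀ : ↥A} {x₀ : H} (hf₀ : ‖f₀‖ ≤ 1) (hx₀ : ‖x₀‖ = 1) (hext : ‖γ f₀ x₀‖ = ‖γ‖) :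
    ⟪x₀, γ f₀ x₀⟫_ℂ = 0 := by
  set M := ‖γ‖ with hM
  set c := ⟪x₀, γ f₀ x₀⟫_ℂ with hc
  have hT : ‖γ f₀‖ ≤ M := (γ.le_opNorm f₀).trans (mul_le_of_le_one_right (norm_nonneg _) hf₀)
  have hcM : ‖c‖ ≤ M := by
    simpa [hx₀, hext] using norm_inner_le_norm (𝕜 := ℂ) x₀ (γ f₀ x₀)
  have hquad : ∀ a : ℂ, ‖a‖ ≤ 1 / 2 →
      2 * (M ^ 2 - 1) * (starRingEnd ℂ a * c).re ≤ 4 * M ^ 2 * ‖a‖ ^ 2 := by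
    intro a ha
    set g : ↥A := f₀ + (starRingEnd ℂ a • (f₀ * f₀) - a • 1) with hg
    have hgnorm : ‖g‖ ≤ √(1 + 4 * ‖a‖ ^ 2) := by
      change ‖(g : C(K, ℂ))‖ ≤ _
      rw [ContinuousMap.norm_le _ (Real.sqrt_nonneg _)]
      intro k
      apply Real.le_sqrt_of_sq_le
      have hk : ‖(f₀ : C(K, ℂ)) k‖ ≤ 1 := ((f₀ : C(K, ℂ)).norm_coe_le_norm k).trans hf₀
      simpa [hg] using norm_sq_mobius_expansion_le hk ha
    have hgx : γ g x₀ = γ f₀ x₀ + (starRingEnd ℂ a • γ f₀ (γ f₀ x₀) - a • x₀) := by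
      simp [hg, hmul, hone]
    have hle : ‖γ g x₀‖ ≤ M * √(1 + 4 * ‖a‖ ^ 2) := by
      calc ‖γ g x₀‖ ≤ ‖γ g‖ * ‖x₀‖ := (γ g).le_opNorm x₀
        _ = ‖γ g‖ := by rw [hx₀, mul_one]
        _ ≤ M * ‖g‖ := γ.le_opNorm g
        _ ≤ M * √(1 + 4 * ‖a‖ ^ 2) := by gcongr
    have hle2 : ‖γ g x₀‖ ^ 2 ≤ M ^ 2 * (1 + 4 * ‖a‖ ^ 2) := by
      calc _ ≤ (M * √(1 + 4 * ‖a‖ ^ 2)) ^ 2 := by gcongr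
        _ = _ := by rw [mul_pow, Real.sq_sqrt (by positivity)]
    have hsecond : ⟪γ f₀ x₀, γ f₀ (γ f₀ x₀)⟫_ℂ = ((M ^ 2 : ℝ) : ℂ) * c := by
      rw [← ContinuousLinearMap.adjoint_inner_left,
        adjoint_apply_apply_of_norm_attained hT hx₀ hext, inner_smul_left, Complex.conj_ofReal]
    have hcross : RCLike.re ⟪γ f₀ x₀, starRingEnd ℂ a • γ f₀ (γ f₀ x₀) - a • x₀⟫_ℂ
        = (M ^ 2 - 1) * (starRingEnd ℂ a * c).re := by
      rw [inner_sub_right, inner_smul_right, inner_smul_right, hsecond,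
        ← inner_conj_symm (γ f₀ x₀) x₀, ← hc]
      simp only [RCLike.re_eq_complex_re, Complex.sub_re, Complex.mul_re, Complex.mul_im,
        Complex.conj_re, Complex.conj_im, Complex.ofReal_re, Complex.ofReal_im]
      ring
    have hexp := norm_add_sq (𝕜 := ℂ) (γ f₀ x₀) (starRingEnd ℂ a • γ f₀ (γ f₀ x₀) - a • x₀)
    rw [← hgx, hcross, hext] at hexp
    nlinarith [sq_nonneg ‖starRingEnd ℂ a • γ f₀ (γ f₀ x₀) - a • x₀‖]
  by_contra hne
  have hcpos : 0 < ‖c‖ ^ 2 := by positivity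
  have hMpos : 0 < M := by linarith
  have hM2 : 0 < M ^ 2 - 1 := by nlinarith
  set t : ℝ := (M ^ 2 - 1) / (4 * M ^ 3) with ht
  have htpos : 0 < t := by positivity
  have htM : 4 * M ^ 3 * t = M ^ 2 - 1 := by rw [ht]; field_simp
  have htM_le : t * M ≤ 1 / 2 := by
    have : M ^ 2 * (t * M) ≤ M ^ 2 * (1 / 2) := by nlinarith
    exact le_of_mul_le_mul_left this (by positivity)
  have hnorm : ‖(t : ℂ) * c‖ = t * ‖c‖ := by
    rw [norm_mul, Complex.norm_real, Real.norm_of_nonneg htpos.le]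
  have hre : (starRingEnd ℂ ((t : ℂ) * c) * c).re = t * ‖c‖ ^ 2 := by
    simp only [map_mul, Complex.conj_ofReal, Complex.sq_norm, Complex.normSq_apply,
      Complex.mul_re, Complex.mul_im, Complex.conj_re, Complex.conj_im, Complex.ofReal_re,
      Complex.ofReal_im]
    ring
  have h := hquad (t * c) (by rw [hnorm]; nlinarith)
  rw [hnorm, hre] at h
  have hscaled : (t * ‖c‖ ^ 2) * (2 * (M ^ 2 - 1)) ≤ (t * ‖c‖ ^ 2) * (4 * M ^ 2 * t) := by linarith
  have hbound := le_of_mul_le_mul_left hscaled (by positivity)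
  nlinarith [mul_le_mul_of_nonneg_left hbound hMpos.le]

/-- **Key inequality in the proof of the Main Theorem.** Let `γ : A → L(H)` be a
unital bounded homomorphism with `‖γ‖ > 1` admitting an extremal pair
`(f₀, x₀)`, and let `Φ : A → A` be a bounded antilinear map with associated map
`γ_Φ(f) = γ(f) + γ(Φ(f))*`. Then for every bounded linear functional `ω` on `A`,
`‖γ‖² ≤ ‖γ‖ ‖γ_Φ − ω‖ + |⟨γ(Φ(f₀)f₀)x₀, x₀⟩|`. -/
theorem stmt_6 {K : Type*} [TopologicalSpace K] [CompactSpace K] [T2Space K]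
    (A : Subalgebra ℂ C(K, ℂ)) (hA : IsClosed (A : Set C(K, ℂ)))
    {H : Type*} [NormedAddCommGroup H] [InnerProductSpace ℂ H] [CompleteSpace H]
    (γ : ↥A →L[ℂ] (H →L[ℂ] H))
    (hmul : ∀ f g : ↥A, γ (f * g) = γ f * γ g) (hone : γ 1 = 1)
    (Φ : ↥A →SL[starRingEnd ℂ] ↥A)
    (γΦ : ↥A →L[ℂ] (H →L[ℂ] H))
    (hγΦ : ∀ f : ↥A, γΦ f = γ f + ContinuousLinearMap.adjoint (γ (Φ f)))
    (hγ : 1 < ‖γ‖)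
    (f₀ : ↥A) (x₀ : H) (hf₀ : ‖f₀‖ = 1) (hx₀ : ‖x₀‖ = 1)
    (hext : ‖γ f₀ x₀‖ = ‖γ‖) :
    ∀ ω : ↥A →L[ℂ] ℂ,
      ‖γ‖ ^ 2 ≤ ‖γ‖ * ‖γΦ - ω.smulRight (1 : H →L[ℂ] H)‖ +
        ‖⟪x₀, γ (Φ f₀ * f₀) x₀⟫_ℂ‖ := by
  intro ω
  have horth := inner_extremal_eq_zero hmul hone hγ hf₀.le hx₀ hext
  set S := γΦ - ω.smulRight (1 : H →L[ℂ] H) with hS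
  have hSx : S f₀ x₀ = γ f₀ x₀ + ContinuousLinearMap.adjoint (γ (Φ f₀)) x₀ - ω f₀ • x₀ := by
    simp [hS, hγΦ]
  have hinner : ⟪S f₀ x₀, γ f₀ x₀⟫_ℂ = (‖γ‖ : ℂ) ^ 2 + ⟪x₀, γ (Φ f₀ * f₀) x₀⟫_ℂ := by
    rw [hSx, inner_sub_left, inner_add_left, inner_smul_left, horth, inner_self_eq_norm_sq_to_K,
      hext, ContinuousLinearMap.adjoint_inner_left, hmul]
    simp
  have hnorm : ‖S f₀ x₀‖ ≤ ‖S‖ := by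
    calc ‖S f₀ x₀‖ ≤ ‖S f₀‖ * ‖x₀‖ := (S f₀).le_opNorm x₀
      _ ≤ ‖S‖ * ‖f₀‖ * ‖x₀‖ := by gcongr; exact S.le_opNorm f₀
      _ = ‖S‖ := by rw [hf₀, hx₀, mul_one, mul_one]
  calc ‖γ‖ ^ 2 = ‖(‖γ‖ : ℂ) ^ 2‖ := by simp
    _ = ‖⟪S f₀ x₀, γ f₀ x₀⟫_ℂ - ⟪x₀, γ (Φ f₀ * f₀) x₀⟫_ℂ‖ := by rw [hinner, add_sub_cancel_right]
    _ ≤ ‖⟪S f₀ x₀, γ f₀ x₀⟫_ℂ‖ + ‖⟪x₀, γ (Φ f₀ * f₀) x₀⟫_ℂ‖ := norm_sub_le _ _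
    _ ≤ ‖γ‖ * ‖S‖ + ‖⟪x₀, γ (Φ f₀ * f₀) x₀⟫_ℂ‖ := by
      gcongr
      calc ‖⟪S f₀ x₀, γ f₀ x₀⟫_ℂ‖ ≤ ‖S f₀ x₀‖ * ‖γ f₀ x₀‖ := norm_inner_le_norm _ _
        _ ≤ ‖γ‖ * ‖S‖ := by rw [hext, mul_comm]; gcongr
end

section
/- The supremum, over all pairs of complex numbers a, b with |a| ≤ 1 and |b| ≤ 1, of the operator norm of the 2×2 complex matrix [[b, b − a], [0, a]] acting on ℂ² with the Euclidean (ℓ²) norm, equals 1 + √2. -/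
/-- The norm-squared estimate behind the bound `1 + √2`. -/
theorem sq_add_two_mul_add_sq_le (s t : ℝ) :
    (s + 2 * t) ^ 2 + t ^ 2 ≤ (1 + √2) ^ 2 * (s ^ 2 + t ^ 2) := by
  have h2 : √2 ^ 2 = 2 := Real.sq_sqrt zero_le_two
  have key : (1 + √2) ^ 2 * (s ^ 2 + t ^ 2) - ((s + 2 * t) ^ 2 + t ^ 2) =
      (2 + 2 * √2) * (s - (√2 - 1) * t) ^ 2 := by
    linear_combination (s ^ 2 + t ^ 2 - (2 * t ^ 2 * √2 - 2 * t ^ 2 - 4 * s * t)) * h2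
  have : 0 ≤ (2 + 2 * √2) * (s - (√2 - 1) * t) ^ 2 := by positivity
  linarith

theorem norm_sq_toEuclideanCLM_apply (a b : ℂ) (v : EuclideanSpace ℂ (Fin 2)) :
    ‖Matrix.toEuclideanCLM (𝕜 := ℂ) (n := Fin 2) !![b, b - a; 0, a] v‖ ^ 2 =
      ‖b * v 0 + (b - a) * v 1‖ ^ 2 + ‖a * v 1‖ ^ 2 := by
  simp [EuclideanSpace.norm_sq_eq, Matrix.ofLp_toEuclideanCLM, Matrix.mulVec, dotProduct,
    Fin.sum_univ_two]

theorem norm_toEuclideanCLM_le {a b : ℂ} (ha : ‖a‖ ≤ 1) (hb : ‖b‖ ≤ 1) :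
    ‖Matrix.toEuclideanCLM (𝕜 := ℂ) (n := Fin 2) !![b, b - a; 0, a]‖ ≤ 1 + √2 := by
  refine ContinuousLinearMap.opNorm_le_bound _ (by positivity) fun v => ?_
  refine (sq_le_sq₀ (by positivity) (by positivity)).1 ?_
  rw [norm_sq_toEuclideanCLM_apply, mul_pow, EuclideanSpace.norm_sq_eq, Fin.sum_univ_two]
  refine le_trans ?_ (sq_add_two_mul_add_sq_le ‖v 0‖ ‖v 1‖)
  have hba : ‖b - a‖ ≤ 2 := (norm_sub_le b a).trans (by linarith)
  have hfst : ‖b * v 0 + (b - a) * v 1‖ ≤ ‖v 0‖ + 2 * ‖v 1‖ := by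
    refine (norm_add_le _ _).trans ?_
    rw [norm_mul, norm_mul]
    exact add_le_add (mul_le_of_le_one_left (norm_nonneg _) hb) (by gcongr)
  have hsnd : ‖a * v 1‖ ≤ ‖v 1‖ := by
    rw [norm_mul]
    exact mul_le_of_le_one_left (norm_nonneg _) ha
  gcongr

theorem le_norm_toEuclideanCLM :
    1 + √2 ≤ ‖Matrix.toEuclideanCLM (𝕜 := ℂ) (n := Fin 2)
      !![(1 : ℂ), 1 - (-1); 0, -1]‖ := by
  have h2 : √2 ^ 2 = 2 := Real.sq_sqrt zero_le_two
  set v : EuclideanSpace ℂ (Fin 2) := !₂[((√2 - 1 : ℝ) : ℂ), 1] with hv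
  have hvsq : ‖v‖ ^ 2 = (√2 - 1) ^ 2 + 1 := by
    rw [EuclideanSpace.norm_sq_eq, Fin.sum_univ_two]
    simp only [hv, PiLp.toLp_apply, Matrix.cons_val_zero, Matrix.cons_val_one,
      Complex.norm_real, Real.norm_eq_abs, sq_abs, norm_one, one_pow]
  have hvpos : 0 < ‖v‖ := by
    by_contra! h
    nlinarith [norm_nonneg v, sq_nonneg (√2 - 1)]
  refine le_of_mul_le_mul_right (le_trans ?_ (ContinuousLinearMap.le_opNorm _ v)) hvpos
  refine (sq_le_sq₀ (by positivity) (by positivity)).1 ?_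
  rw [norm_sq_toEuclideanCLM_apply, mul_pow, hvsq]
  have hfst : (1 : ℂ) * v 0 + (1 - -1) * v 1 = ((√2 + 1 : ℝ) : ℂ) := by
    simp [hv]
  rw [hfst, Complex.norm_real, Real.norm_eq_abs, sq_abs]
  have hsnd : ‖(-1 : ℂ) * v 1‖ = 1 := by simp [hv]
  rw [hsnd]
  nlinarith

/-- **Sharpness example (Ransford–Schwenninger).** The supremum over `|a| ≤ 1`,
`|b| ≤ 1` of the Euclidean operator norm of the matrix `[[b, b − a], [0, a]]`
on `ℂ²` equals `1 + √2`. -/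
theorem stmt_8 :
    sSup { r : ℝ | ∃ a b : ℂ, ‖a‖ ≤ 1 ∧ ‖b‖ ≤ 1 ∧
        r = ‖Matrix.toEuclideanCLM (𝕜 := ℂ) (n := Fin 2) !![b, b - a; 0, a]‖ } =
      1 + Real.sqrt 2 := by
  refine IsGreatest.csSup_eq ⟨⟨-1, 1, by simp, by simp, ?_⟩, ?_⟩
  · exact le_antisymm le_norm_toEuclideanCLM (norm_toEuclideanCLM_le (by simp) (by simp))
  · rintro r ⟨a, b, ha, hb, rfl⟩
    exact norm_toEuclideanCLM_le ha hb
end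

section
/- Let x₀ ∈ ℂ² be the vector ( √(2 − √2)/2 , √(2 + √2)/2 ). Then ‖x₀‖ = 1 in the Euclidean norm, and the matrix M = [[1, 2], [0, −1]] satisfies ‖M x₀‖ = 1 + √2; consequently the operator norm of M on Euclidean ℂ² equals 1 + √2. -/
theorem norm_toEuclideanCLM_one_two_zero_neg_one_sq (x : EuclideanSpace ℂ (Fin 2)) :
    ‖Matrix.toEuclideanCLM (𝕜 := ℂ) (n := Fin 2) !![1, 2; 0, -1] x‖ ^ 2 =
      ‖x 0 + 2 * x 1‖ ^ 2 + ‖x 1‖ ^ 2 := by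
  rw [EuclideanSpace.norm_sq_eq, Fin.sum_univ_two]
  simp [Matrix.ofLp_toEuclideanCLM, Matrix.mulVec, dotProduct, Fin.sum_univ_two]

theorem norm_toEuclideanCLM_one_two_zero_neg_one_le (x : EuclideanSpace ℂ (Fin 2)) :
    ‖Matrix.toEuclideanCLM (𝕜 := ℂ) (n := Fin 2) !![1, 2; 0, -1] x‖ ≤
      (1 + Real.sqrt 2) * ‖x‖ := by
  have hs : Real.sqrt 2 ^ 2 = 2 := Real.sq_sqrt (by norm_num)
  refine (sq_le_sq₀ (norm_nonneg _) (by positivity)).mp ?_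
  rw [norm_toEuclideanCLM_one_two_zero_neg_one_sq, mul_pow, EuclideanSpace.norm_sq_eq,
    Fin.sum_univ_two]
  simp only [Complex.sq_norm, Complex.normSq_apply, Complex.add_re, Complex.add_im,
    Complex.mul_re, Complex.mul_im, Complex.re_ofNat, Complex.im_ofNat]
  have key : ∀ a b : ℝ, (a + 2 * b) ^ 2 + b ^ 2 ≤ (1 + Real.sqrt 2) ^ 2 * (a ^ 2 + b ^ 2) := by
    intro a b
    have h : (1 + Real.sqrt 2) ^ 2 * (a ^ 2 + b ^ 2) - ((a + 2 * b) ^ 2 + b ^ 2) =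
        (2 + 2 * Real.sqrt 2) * (a - (Real.sqrt 2 - 1) * b) ^ 2 := by
      linear_combination
        (a ^ 2 + b ^ 2 + 4 * a * b - 2 * b ^ 2 * Real.sqrt 2 + 2 * b ^ 2) * hs
    have : 0 ≤ (2 + 2 * Real.sqrt 2) * (a - (Real.sqrt 2 - 1) * b) ^ 2 := by positivity
    linarith
  linarith [key (x 0).re (x 1).re, key (x 0).im (x 1).im]

/-- **Extremal vector in the Ransford–Schwenninger example.** The vector
`x₀ = (√(2 − √2)/2, √(2 + √2)/2)` is a unit vector in Euclidean `ℂ²`, the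
matrix `M = [[1, 2], [0, −1]]` attains `‖M x₀‖ = 1 + √2` on it, and its
operator norm equals `1 + √2`. -/
theorem stmt_9
    (x₀ : EuclideanSpace ℂ (Fin 2))
    (hx₀ : x₀ = (WithLp.equiv 2 (Fin 2 → ℂ)).symm
      ![((Real.sqrt (2 - Real.sqrt 2) / 2 : ℝ) : ℂ),
        ((Real.sqrt (2 + Real.sqrt 2) / 2 : ℝ) : ℂ)]) :
    ‖x₀‖ = 1 ∧
      ‖Matrix.toEuclideanCLM (𝕜 := ℂ) (n := Fin 2) !![1, 2; 0, -1] x₀‖ =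
        1 + Real.sqrt 2 ∧
      ‖Matrix.toEuclideanCLM (𝕜 := ℂ) (n := Fin 2) !![1, 2; 0, -1]‖ =
        1 + Real.sqrt 2 := by
  have hs : Real.sqrt 2 ^ 2 = 2 := Real.sq_sqrt (by norm_num)
  have hs2 : Real.sqrt 2 ≤ 2 := by nlinarith [Real.sqrt_nonneg 2]
  have ha := Real.sq_sqrt (sub_nonneg.mpr hs2)
  have hb := Real.sq_sqrt (show 0 ≤ 2 + Real.sqrt 2 by positivity)
  have hab : Real.sqrt (2 - Real.sqrt 2) * Real.sqrt (2 + Real.sqrt 2) = Real.sqrt 2 := by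
    rw [← Real.sqrt_mul (sub_nonneg.mpr hs2)]
    congr 1
    linear_combination -hs
  have h0 : x₀ 0 = ((Real.sqrt (2 - Real.sqrt 2) / 2 : ℝ) : ℂ) := by simp [hx₀]
  have h1 : x₀ 1 = ((Real.sqrt (2 + Real.sqrt 2) / 2 : ℝ) : ℂ) := by simp [hx₀]
  have hnorm : ‖x₀‖ = 1 := by
    refine (sq_eq_sq₀ (norm_nonneg _) zero_le_one).mp ?_
    rw [EuclideanSpace.norm_sq_eq, Fin.sum_univ_two, h0, h1, Complex.norm_real, Complex.norm_real,
      Real.norm_eq_abs, Real.norm_eq_abs, sq_abs, sq_abs]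
    linear_combination (ha + hb) / 4
  have hM : ‖Matrix.toEuclideanCLM (𝕜 := ℂ) (n := Fin 2) !![1, 2; 0, -1] x₀‖ =
      1 + Real.sqrt 2 := by
    refine (sq_eq_sq₀ (norm_nonneg _) (by positivity)).mp ?_
    rw [norm_toEuclideanCLM_one_two_zero_neg_one_sq, h0, h1, ← Complex.ofReal_ofNat,
      ← Complex.ofReal_mul, ← Complex.ofReal_add, Complex.norm_real, Complex.norm_real,
      Real.norm_eq_abs, Real.norm_eq_abs, sq_abs, sq_abs]
    linear_combination ha / 4 + 5 / 4 * hb + hab - hs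
  refine ⟨hnorm, hM, le_antisymm ?_ ?_⟩
  · exact ContinuousLinearMap.opNorm_le_bound _ (by positivity)
      norm_toEuclideanCLM_one_two_zero_neg_one_le
  · rw [← hM]
    exact ContinuousLinearMap.unit_le_opNorm _ _ hnorm.le
end

section
/- Let M be a bounded linear operator on a complex Hilbert space H, let x ∈ H and d ∈ ℕ. Let V be the (finite-dimensional) subspace of H spanned by x, Mx, …, M^d x, let Π : H → V be the orthogonal projection onto V, and let M↓ : V → V be the compression M↓ = Π ∘ M ∘ ι, where ι : V → H is the inclusion. Then for every polynomial p ∈ ℂ[X] with deg p ≤ d, one has p(M)x = ι( p(M↓)(Π x) ); in particular p(M)x = p(M↓)x, viewing x as an element of V. -/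
open scoped InnerProductSpace

/-- A map `proj` onto `V` whose residuals are orthogonal to `V` fixes the vectors of `V`. -/
theorem coe_proj_eq_self_of_mem {𝕜 E : Type*} [RCLike 𝕜] [NormedAddCommGroup E]
    [InnerProductSpace 𝕜 E] {V : Submodule 𝕜 E} {proj : E → V}
    (hproj : ∀ y : E, y - (proj y : E) ∈ Vᗮ) {y : E} (hy : y ∈ V) : (proj y : E) = y := by
  have hmem : y - (proj y : E) ∈ V := V.sub_mem hy (proj y).2
  have hzero : y - (proj y : E) = 0 :=
    inner_self_eq_zero.mp ((V.mem_orthogonal _).mp (hproj y) _ hmem)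
  exact (sub_eq_zero.mp hzero).symm

/-- If `x, M x, …, M ^ d x` all lie in `V` and `proj` fixes `V`, then the powers of the compression
of `M` to `V` agree with the powers of `M` on `x`, up to exponent `d`. -/
theorem coe_compression_pow_apply {𝕜 E : Type*} [RCLike 𝕜] [NormedAddCommGroup E]
    [NormedSpace 𝕜 E] {M : E →L[𝕜] E} {x : E} {d : ℕ} {V : Submodule 𝕜 E} {proj : E →L[𝕜] V}
    (hfix : ∀ y ∈ V, (proj y : E) = y) (hmem : ∀ n ≤ d, (M ^ n) x ∈ V) {n : ℕ} (hn : n ≤ d) :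
    (((proj.comp (M.comp V.subtypeL)) ^ n) (proj x) : E) = (M ^ n) x := by
  induction n with
  | zero => simpa using hfix x (by simpa using hmem 0 hn)
  | succ n ih =>
    have hM : M ((M ^ n) x) = (M ^ (n + 1)) x := by rw [pow_succ']; rfl
    rw [pow_succ', mul_apply_eq_comp, ContinuousLinearMap.comp_apply,
      ContinuousLinearMap.comp_apply, Submodule.subtypeL_apply, ih (Nat.le_of_succ_le hn), hM]
    exact hfix _ (hmem _ hn)

/-- **Krylov subspace compression.** Let `M` be a bounded operator on a
complex Hilbert space `H`, `x ∈ H`, `d ∈ ℕ`, let `V` be the subspace spanned by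
`x, Mx, …, M^d x`, `proj : H → V` the orthogonal projection (characterized by
`y − proj y ∈ Vᗮ`), and `M↓ = proj ∘ M ∘ ι` the compression of `M` to `V`.
Then `p(M) x = ι (p(M↓) (proj x))` for every polynomial `p` of degree `≤ d`. -/
theorem stmt_11 {H : Type*} [NormedAddCommGroup H] [InnerProductSpace ℂ H]
    [CompleteSpace H] (M : H →L[ℂ] H) (x : H) (d : ℕ)
    (V : Submodule ℂ H)
    (hV : V = Submodule.span ℂ (Set.range fun i : Fin (d + 1) => (M ^ (i : ℕ)) x))
    (proj : H →L[ℂ] V) (hproj : ∀ y : H, y - (proj y : H) ∈ Vᗮ)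
    (p : Polynomial ℂ) (hp : p.natDegree ≤ d) :
    Polynomial.aeval M p x =
      ((Polynomial.aeval (proj.comp (M.comp V.subtypeL)) p) (proj x) : H) := by
  have hmem : ∀ n ≤ d, (M ^ n) x ∈ V := fun n hn => by
    rw [hV]
    exact Submodule.subset_span ⟨⟨n, Nat.lt_succ_of_le hn⟩, rfl⟩
  simp only [Polynomial.aeval_eq_sum_range, sum_apply,
    smul_apply, Submodule.coe_sum, Submodule.coe_smul]
  refine Finset.sum_congr rfl fun n hn => ?_
  rw [coe_compression_pow_apply (fun _ => coe_proj_eq_self_of_mem hproj) hmem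
    ((Nat.le_of_lt_succ (Finset.mem_range.mp hn)).trans hp)]
end

section
/- Let M be a bounded linear operator on a complex Hilbert space H, let κ > 0, and let S ⊆ ℂ be a nonempty bounded set. Suppose that for every finite-dimensional subspace V of H, with orthogonal projection Π : H → V, inclusion ι : V → H, and compression M↓ = Π ∘ M ∘ ι on V, one has ‖p(M↓)‖ ≤ κ · sup_{z ∈ S} |p(z)| for every polynomial p ∈ ℂ[X]. Then ‖p(M)‖ ≤ κ · sup_{z ∈ S} |p(z)| for every polynomial p ∈ ℂ[X]. -/
open Polynomial in
/-- If `M ^ k x ∈ V` for all `k ≤ deg p` and `proj` fixes `V`, then the compression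
`proj ∘ M ∘ ι` of `M` to `V` satisfies `p(proj ∘ M ∘ ι) x = p(M) x`. -/
theorem coe_aeval_compression_apply {H : Type*} [NormedAddCommGroup H] [NormedSpace ℂ H]
    (M : H →L[ℂ] H) (V : Submodule ℂ H) (proj : H →L[ℂ] V) (hproj : ∀ v : V, proj v = v)
    (p : ℂ[X]) (x : V) (hx : ∀ k ≤ p.natDegree, (M ^ k) (x : H) ∈ V) :
    (aeval (proj.comp (M.comp V.subtypeL)) p x : H) = aeval M p (x : H) := by
  have hpow : ∀ k ≤ p.natDegree,
      (((proj.comp (M.comp V.subtypeL)) ^ k) x : H) = (M ^ k) (x : H) := by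
    intro k hk
    induction k with
    | zero => simp
    | succ k ih =>
      have hmem := hx (k + 1) hk
      rw [pow_succ', mul_apply_eq_comp] at hmem ⊢
      rw [pow_succ', mul_apply_eq_comp]
      simp only [ContinuousLinearMap.comp_apply, Submodule.subtypeL_apply]
      rw [ih (by lia)]
      exact congrArg Subtype.val (hproj ⟨_, hmem⟩)
  simp only [aeval_eq_sum_range, sum_apply, smul_apply,
    Submodule.coe_sum, Submodule.coe_smul]
  refine Finset.sum_congr rfl fun k hk => ?_
  rw [hpow k (Nat.lt_succ_iff.mp (Finset.mem_range.mp hk))]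

/-- **Proposition (reduction to finite-dimensional compressions).** Let `M` be
a bounded operator on a complex Hilbert space `H`, `κ > 0` and `S ⊆ ℂ`
nonempty and bounded. If `‖p(M↓)‖ ≤ κ sup_{z ∈ S} |p(z)|` for every polynomial
`p` and every compression `M↓ = proj ∘ M ∘ ι` of `M` to a finite-dimensional
subspace `V` (with `proj` the orthogonal projection onto `V`), then
`‖p(M)‖ ≤ κ sup_{z ∈ S} |p(z)|` for every polynomial `p`. -/
theorem stmt_12 {H : Type*} [NormedAddCommGroup H] [InnerProductSpace ℂ H]
    [CompleteSpace H] (M : H →L[ℂ] H) (κ : ℝ) (hκ : 0 < κ)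
    (S : Set ℂ) (hS : S.Nonempty) (hSb : Bornology.IsBounded S)
    (hcomp : ∀ (V : Submodule ℂ H), FiniteDimensional ℂ V →
      ∀ proj : H →L[ℂ] V, (∀ y : H, y - (proj y : H) ∈ Vᗮ) →
      ∀ p : Polynomial ℂ,
        ‖Polynomial.aeval (proj.comp (M.comp V.subtypeL)) p‖ ≤
          κ * ⨆ z : S, ‖p.eval (z : ℂ)‖) :
    ∀ p : Polynomial ℂ, ‖Polynomial.aeval M p‖ ≤ κ * ⨆ z : S, ‖p.eval (z : ℂ)‖ := by
  intro p
  refine ContinuousLinearMap.opNorm_le_bound _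
    (mul_nonneg hκ.le (Real.iSup_nonneg fun _ => norm_nonneg _)) fun x => ?_
  let V : Submodule ℂ H :=
    Submodule.span ℂ ((fun k => (M ^ k) x) '' (Finset.range (p.natDegree + 1) : Set ℕ))
  have : FiniteDimensional ℂ V :=
    FiniteDimensional.span_of_finite ℂ ((Finset.finite_toSet _).image _)
  have hmem : ∀ k ≤ p.natDegree, (M ^ k) x ∈ V := fun k hk =>
    Submodule.subset_span ⟨k, by simpa using Nat.lt_succ_iff.mpr hk, rfl⟩
  have hx : x ∈ V := by simpa using hmem 0 (Nat.zero_le _)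
  have hbound := hcomp V this V.orthogonalProjectionOnto
    (fun y => V.sub_starProjection_mem_orthogonal y) p
  have heq := coe_aeval_compression_apply M V V.orthogonalProjectionOnto
    (fun v => V.orthogonalProjectionOnto_mem_subspace_eq_self v) p ⟨x, hx⟩ hmem
  rw [← heq]
  exact ContinuousLinearMap.le_of_opNorm_le _ hbound (⟨x, hx⟩ : V)
end
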